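/- Let f : [0,1] → ℝ be continuous and 1-Lipschitz, and let C ∈ (0,1] be a constant such that N^f_{{0}}(δ) ≥ C/δ for all sufficiently small δ > 0. Then for all sufficiently small ε > 0 and every positive integer n, N^f_{{0}}(ε/4ⁿ) ≤ (1 − 7C²/36)ⁿ · 4ⁿ/ε. Consequently, choosing n so large that (1 − 7C²/36)ⁿ < C yields a contradiction with the assumed lower bound N^f_{{0}}(ε/4ⁿ) ≥ C·4ⁿ/ε. -/

import Mathlib

open MeasureTheory ENNReal

noncomputable section

/-- `N^f_{{0}}(δ)`: the infimum of the number of zeros (0-dimensional Hausdorff measure,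
i.e. counting measure) over all continuous `h : [0,1] → ℝ` with `‖h - f‖_{C⁰} ≤ δ`. -/
def N0 (f : ℝ → ℝ) (δ : ℝ) : ℝ≥0∞ :=
  ⨅ (h : ℝ → ℝ) (_ : ContinuousOn h (Set.Icc 0 1))
    (_ : ∀ x ∈ Set.Icc (0 : ℝ) 1, |h x - f x| ≤ δ),
    μH[0] {x ∈ Set.Icc (0 : ℝ) 1 | h x = 0}

theorem aux_cross (F : ℝ → ℝ) (hF : LipschitzWith 1 F) (τ x y : ℝ) (hxy : x ≤ y) :
    |max (-τ) (min τ (F y)) - max (-τ) (min τ (F x))| ≤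
      (volume ({t | 0 < |F t| ∧ |F t| < τ} ∩ Set.Ioo x y)).toReal := by
  have key : ∀ a b : ℝ, Set.Ioo a b ⊆ F '' Set.Ioo x y → -τ ≤ a → b ≤ τ →
      b - a ≤ (volume ({t | 0 < |F t| ∧ |F t| < τ} ∩ Set.Ioo x y)).toReal := by
    intro a b h ha hb
    set A := {t | 0 < |F t| ∧ |F t| < τ} ∩ Set.Ioo x y with hA
    have h1 : Set.Ioo a b \ {0} ⊆ F '' A := by
      rintro v ⟨hv, hv0⟩
      obtain ⟨t, ht, rfl⟩ := h hv
      refine ⟨t, ⟨⟨abs_pos.2 hv0, abs_lt.2 ⟨by linarith [hv.1], by linarith [hv.2]⟩⟩, ht⟩, rfl⟩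
    have h2 : volume (F '' A) ≤ volume A := by
      have := (hF.lipschitzOnWith (s := A)).hausdorffMeasure_image_le (d := 1) zero_le_one
      simpa [hausdorffMeasure_real] using this
    have h3 : volume (Set.Ioo a b \ {0}) = ENNReal.ofReal (b - a) := by
      rw [measure_sdiff_null (by simp)]; simp
    have h4 : volume A ≠ ⊤ := by
      refine ne_top_of_le_ne_top ?_ (measure_mono (Set.inter_subset_right))
      simp
    rw [← ENNReal.ofReal_le_iff_le_toReal h4, ← h3]
    exact (measure_mono h1).trans h2
  rcases le_or_gt τ (-τ) with hτ | hτ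
  · rw [max_eq_left ((min_le_left _ _).trans hτ), max_eq_left ((min_le_left _ _).trans hτ)]
    simp
  have hc := hF.continuous
  rw [abs_le]
  constructor
  · have := key (max (-τ) (min τ (F y))) (max (-τ) (min τ (F x))) ?_ (le_max_left _ _)
      (max_le hτ.le (min_le_left _ _))
    · linarith
    · refine subset_trans ?_ (intermediate_value_Ioo' hxy hc.continuousOn)
      rintro v ⟨h1, h2⟩
      grind
  · have := key (max (-τ) (min τ (F x))) (max (-τ) (min τ (F y))) ?_ (le_max_left _ _)
      (max_le hτ.le (min_le_left _ _))
    · linarith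
    · refine subset_trans ?_ (intermediate_value_Ioo hxy hc.continuousOn)
      rintro v ⟨h1, h2⟩
      grind

theorem aux_add (A : Set ℝ) (hA : MeasurableSet A) (x y : ℝ) (hx : 0 ≤ x) (hxy : x ≤ y) :
    (volume (A ∩ Set.Icc 0 x)).toReal + (volume (A ∩ Set.Ioo x y)).toReal ≤
      (volume (A ∩ Set.Icc 0 y)).toReal := by
  have fin : ∀ B : Set ℝ, B ⊆ Set.Icc 0 y → volume B ≠ ⊤ := fun B hB =>
    ne_top_of_le_ne_top (by simp) (measure_mono hB)
  have s1 : A ∩ Set.Icc 0 x ⊆ Set.Icc 0 y := fun t ht => ⟨ht.2.1, ht.2.2.trans hxy⟩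
  have s2 : A ∩ Set.Ioo x y ⊆ Set.Icc 0 y := fun t ht => ⟨hx.trans ht.2.1.le, ht.2.2.le⟩
  rw [← ENNReal.toReal_add (fin _ s1) (fin _ s2)]
  apply ENNReal.toReal_mono (fin _ Set.inter_subset_right)
  rw [← measure_union _ (hA.inter measurableSet_Ioo)]
  · apply measure_mono
    rintro t (ht | ht)
    · exact ⟨ht.1, s1 ht⟩
    · exact ⟨ht.1, s2 ht⟩
  · rw [Set.disjoint_left]
    rintro t ht ht'
    exact absurd ht.2.2 (not_le.2 ht'.2.1)

theorem aux_ind (F : ℝ → ℝ) (hF : LipschitzWith 1 F) (δ η : ℝ) (hδ : 0 < δ) (hη : 0 < η)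
    (hηδ : η ≤ δ / 4) (i : ℕ) :
    ∃ (h : ℝ → ℝ) (s : ℝ) (K : ℕ), Continuous h ∧ (s = 1 ∨ s = -1) ∧
      (∀ x, i * η ≤ x → h x = F (i * η) + s * (3 * δ / 4)) ∧
      -(δ / 2) ≤ s * F (i * η) ∧
      (∀ x, 0 ≤ x → x ≤ i * η → |h x - F x| ≤ δ) ∧
      Set.encard {x | 0 ≤ x ∧ x ≤ i * η ∧ h x = 0} ≤ K ∧
      K * δ + δ / 2 - s * max (-(δ / 2)) (min (δ / 2) (F (i * η))) ≤ δ +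
        (volume ({t | 0 < |F t| ∧ |F t| < δ / 2} ∩ Set.Icc 0 (i * η))).toReal := by
  have hA : MeasurableSet {t | 0 < |F t| ∧ |F t| < δ / 2} := by
    have hc := hF.continuous.abs
    exact ((isOpen_lt continuous_const hc).inter (isOpen_lt hc continuous_const)).measurableSet
  have hL : ∀ x y, |F x - F y| ≤ |x - y| := by
    intro x y
    have := hF.dist_le_mul x y
    simpa [Real.dist_eq] using this
  induction i with
  | zero =>
    obtain ⟨s, hs, h0⟩ : ∃ s : ℝ, (s = 1 ∨ s = -1) ∧ 0 ≤ s * F 0 := by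
      rcases le_total 0 (F 0) with h | h
      · exact ⟨1, Or.inl rfl, by linarith⟩
      · exact ⟨-1, Or.inr rfl, by linarith⟩
    refine ⟨fun _ => F 0 + s * (3 * δ / 4), s, 0, continuous_const, hs, ?_, ?_, ?_, ?_, ?_⟩
    · intro x _; simp
    · simp; linarith
    · intro x h1 h2
      have : x = 0 := le_antisymm (by simpa using h2) h1
      subst this
      rcases hs with rfl | rfl <;> rw [abs_le] <;> constructor <;> linarith
    · refine le_of_eq (Set.encard_eq_zero.2 (Set.eq_empty_iff_forall_notMem.2 ?_))
      rintro x ⟨_, _, h3⟩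
      rcases hs with rfl | rfl <;> linarith
    · have := ENNReal.toReal_nonneg (a := volume ({t | 0 < |F t| ∧ |F t| < δ / 2} ∩ Set.Icc 0 (((0:ℕ):ℝ) * η)))
      have e : ((0:ℕ):ℝ) * η = 0 := by simp
      rw [e] at this ⊢
      rcases hs with rfl | rfl
      · have : -(δ/2) ≤ max (-(δ / 2)) (min (δ / 2) (F 0)) := le_max_left _ _
        push_cast; linarith
      · have : max (-(δ / 2)) (min (δ / 2) (F 0)) ≤ δ / 2 := max_le (by linarith) (min_le_left _ _)
        push_cast; linarith
  | succ i ih =>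
    obtain ⟨h, s, K, hc, hs, hconst, hpos, hclose, hcard, hpot⟩ := ih
    obtain ⟨x, hx⟩ : ∃ x, x = (i : ℝ) * η := ⟨_, rfl⟩
    obtain ⟨y, hy⟩ : ∃ y, y = ((i + 1 : ℕ) : ℝ) * η := ⟨_, rfl⟩
    have hxy : y = x + η := by rw [hx, hy]; push_cast; ring
    rw [← hy]
    rw [← hx] at hconst hpos hclose hcard hpot
    have hx0 : 0 ≤ x := by rw [hx]; positivity
    have hcr := aux_cross F hF (δ / 2) x y (by linarith)
    have hadd := aux_add _ hA x y hx0 (by linarith)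
    obtain ⟨s', K', hs', hpos', hKK, hpot'⟩ : ∃ (s' : ℝ) (K' : ℕ), (s' = 1 ∨ s' = -1) ∧
        -(δ / 2) ≤ s' * F y ∧ ((s' = s ∧ K' = K) ∨ (s' = -s ∧ K' = K + 1)) ∧
        K' * δ + δ / 2 - s' * max (-(δ / 2)) (min (δ / 2) (F y)) ≤ 
          K * δ + δ / 2 - s * max (-(δ / 2)) (min (δ / 2) (F y)) := by
      rcases le_total (-(δ / 2)) (s * F y) with hh | hh
      · exact ⟨s, K, hs, hh, Or.inl ⟨rfl, rfl⟩, le_rfl⟩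
      · refine ⟨-s, K + 1, ?_, by linarith, Or.inr ⟨rfl, rfl⟩, ?_⟩
        · rcases hs with rfl | rfl <;> simp
        · rcases hs with rfl | rfl
          · rw [min_eq_right (by linarith), max_eq_left (by linarith)]
            push_cast; linarith
          · rw [min_eq_left (by linarith), max_eq_right (by linarith)]
            push_cast; linarith
    obtain ⟨g, hg⟩ : ∃ g, g = F x + s * (3 * δ / 4) := ⟨_, rfl⟩
    obtain ⟨g', hg'⟩ : ∃ g', g' = F y + s' * (3 * δ / 4) := ⟨_, rfl⟩
    have hle : ∀ t, t ≤ x → max 0 (min 1 ((t - x) / η)) = 0 := fun t ht => by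
      apply max_eq_left
      exact (min_le_right _ _).trans (div_nonpos_of_nonpos_of_nonneg (by linarith) hη.le)
    have hge : ∀ t, y ≤ t → max 0 (min 1 ((t - x) / η)) = 1 := fun t ht => by
      rw [min_eq_left, max_eq_right zero_le_one]
      rw [le_div_iff₀ hη]; linarith
    have hmid : ∀ t, x ≤ t → t ≤ y → max 0 (min 1 ((t - x) / η)) = (t - x) / η ∧
        0 ≤ (t - x) / η ∧ (t - x) / η ≤ 1 := fun t h1 h2 => by
      have a1 : 0 ≤ (t - x) / η := div_nonneg (by linarith) hη.le
      have a2 : (t - x) / η ≤ 1 := by rw [div_le_one hη]; linarith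
      exact ⟨by rw [min_eq_right a2, max_eq_right a1], a1, a2⟩
    refine ⟨fun t => h t + (g' - g) * max 0 (min 1 ((t - x) / η)), s', K', by fun_prop, hs', ?_,
      hpos', ?_, ?_, ?_⟩
    · intro t ht
      simp only
      rw [hge t ht, hconst t (by linarith), ← hg, ← hg']; ring
    · intro t h0 h1
      simp only
      rcases le_total t x with htx | htx
      · rw [hle t htx]; simpa using hclose t h0 htx
      · obtain ⟨e, e0, e1⟩ := hmid t htx h1
        rw [e, hconst t htx, ← hg]
        have b1 : |g - F t| ≤ δ := by
          have := abs_le.1 (hL x t)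
          have : |x - t| ≤ η := by rw [abs_le]; constructor <;> linarith
          rcases hs with rfl | rfl <;> rw [abs_le] <;> constructor <;> linarith
        have b2 : |g' - F t| ≤ δ := by
          have := abs_le.1 (hL y t)
          have : |y - t| ≤ η := by rw [abs_le]; constructor <;> linarith
          rcases hs' with rfl | rfl <;> rw [abs_le] <;> constructor <;> linarith
        rw [abs_le] at *
        generalize (t - x) / η = u at *
        constructor <;> nlinarith
    · rcases hKK with ⟨rfl, rfl⟩ | ⟨rfl, rfl⟩
      · refine (Set.encard_le_encard ?_).trans hcard
        rintro t ⟨h0, h1, h2⟩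
        simp only at h2
        rcases le_total t x with htx | htx
        · rw [hle t htx] at h2
          exact ⟨h0, htx, by simpa using h2⟩
        · exfalso
          obtain ⟨e, e0, e1⟩ := hmid t htx h1
          rw [e, hconst t htx, ← hg] at h2
          generalize (t - x) / η = u at *
          rcases hs with rfl | rfl
          · have : 0 < g := by linarith
            have : 0 < g' := by linarith
            nlinarith
          · have : g < 0 := by linarith
            have : g' < 0 := by linarith
            nlinarith
      · have hne : g' - g ≠ 0 := by
          rcases hs with rfl | rfl
          · have : 0 < g := by linarith
            have : g' < 0 := by linarith
            linarith
          · have : g < 0 := by linarith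
            have : 0 < g' := by linarith
            linarith
        have hsub : {t | 0 ≤ t ∧ t ≤ y ∧ h t + (g' - g) * max 0 (min 1 ((t - x) / η)) = 0} ⊆
            insert (x + η * (-g / (g' - g))) {t | 0 ≤ t ∧ t ≤ x ∧ h t = 0} := by
          rintro t ⟨h0, h1, h2⟩
          rcases le_total t x with htx | htx
          · rw [hle t htx] at h2
            exact Or.inr ⟨h0, htx, by simpa using h2⟩
          · left
            obtain ⟨e, e0, e1⟩ := hmid t htx h1
            rw [e, hconst t htx, ← hg] at h2
            have : -g / (g' - g) = (t - x) / η := by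
              rw [div_eq_iff hne]; linarith
            rw [this]; field_simp; ring
        refine (Set.encard_le_encard hsub).trans ((Set.encard_insert_le _ _).trans ?_)
        push_cast
        gcongr
    · have := abs_le.1 hcr
      rcases hs with rfl | rfl <;> linarith

theorem aux_clamp (x y : ℝ) : |max 0 (min 1 x) - max 0 (min 1 y)| ≤ |x - y| := by
  refine (abs_max_sub_max_le_max _ _ _ _).trans ?_
  rw [sub_self, abs_zero, max_eq_right (abs_nonneg _)]
  refine (abs_min_sub_min_le_max _ _ _ _).trans ?_
  rw [sub_self, abs_zero, max_eq_right (abs_nonneg _)]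

theorem aux_haus (S : Set ℝ) (K : ℕ) (h : S.encard ≤ K) : μH[0] S ≤ (K : ℝ≥0∞) := by
  have hfin : S.Finite := Set.finite_of_encard_le_coe h
  obtain ⟨T, rfl⟩ := hfin.exists_finset_coe
  rw [← sum_measure_singleton]
  simp only [Measure.hausdorffMeasure_zero_singleton]
  rw [Set.encard_coe_eq_coe_finsetCard] at h
  simpa using (by exact_mod_cast h : T.card ≤ K)

theorem aux_small (F : ℝ → ℝ) (hF : Continuous F) (c : ℝ) (hc : 0 < c) :
    ∃ τ₀ > 0, ∀ τ, 0 < τ → τ < τ₀ →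
      (volume ({t | 0 < |F t| ∧ |F t| < τ} ∩ Set.Icc 0 1)).toReal < c := by
  have hm : ∀ τ : ℝ, MeasurableSet ({t | 0 < |F t| ∧ |F t| < τ} ∩ Set.Icc (0:ℝ) 1) := fun τ =>
    ((isOpen_lt continuous_const hF.abs).inter
      (isOpen_lt hF.abs continuous_const)).measurableSet.inter measurableSet_Icc
  have hfin : ∀ τ : ℝ, volume ({t | 0 < |F t| ∧ |F t| < τ} ∩ Set.Icc (0:ℝ) 1) ≠ ⊤ := fun τ =>
    ne_top_of_le_ne_top (by simp) (measure_mono Set.inter_subset_right)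
  have := tendsto_measure_biInter_gt (μ := volume) (a := (0:ℝ))
    (s := fun τ => {t | 0 < |F t| ∧ |F t| < τ} ∩ Set.Icc (0:ℝ) 1)
    (fun r _ => (hm r).nullMeasurableSet)
    (fun i j _ hij t ht => ⟨⟨ht.1.1, ht.1.2.trans_le hij⟩, ht.2⟩) ⟨1, one_pos, hfin 1⟩
  have hemp : (⋂ r > (0:ℝ), {t | 0 < |F t| ∧ |F t| < r} ∩ Set.Icc (0:ℝ) 1) = ∅ := by
    rw [Set.eq_empty_iff_forall_notMem]
    intro t ht
    simp only [Set.mem_iInter] at ht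
    have h1 := (ht 1 one_pos).1.1
    exact lt_irrefl _ (ht _ h1).1.2
  rw [hemp, measure_empty] at this
  have h2 := this.eventually (gt_mem_nhds (ENNReal.ofReal_pos.2 hc))
  obtain ⟨u, hu, h3⟩ := mem_nhdsGT_iff_exists_Ioo_subset.1 h2
  refine ⟨u, hu, fun τ h4 h5 => ?_⟩
  have h6 := h3 ⟨h4, h5⟩
  exact (ENNReal.lt_ofReal_iff_toReal_lt (hfin τ)).1 h6

/-- if `f : [0,1] → ℝ` is 1-Lipschitz and `C ∈ (0,1]` satisfies
`N^f_{{0}}(δ) ≥ C/δ` for all sufficiently small `δ > 0`, then for all sufficiently small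
`ε > 0` and every positive integer `n`, `N^f_{{0}}(ε/4ⁿ) ≤ (1 - 7C²/36)ⁿ · 4ⁿ/ε`;
consequently, taking `n` with `(1 - 7C²/36)ⁿ < C` contradicts the assumed lower bound
`N^f_{{0}}(ε/4ⁿ) ≥ C·4ⁿ/ε`, i.e. the hypotheses are absurd. -/
theorem stmt15 (f : ℝ → ℝ) (hf : ContinuousOn f (Set.Icc 0 1))
    (hlip : ∀ x ∈ Set.Icc (0 : ℝ) 1, ∀ y ∈ Set.Icc (0 : ℝ) 1, |f x - f y| ≤ |x - y|)
    (C : ℝ) (hC0 : 0 < C) (hC1 : C ≤ 1)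
    (hlb : ∃ δ₀ : ℝ, 0 < δ₀ ∧ ∀ δ : ℝ, 0 < δ → δ < δ₀ →
      ENNReal.ofReal (C / δ) ≤ N0 f δ) :
    (∃ ε₀ : ℝ, 0 < ε₀ ∧ ∀ ε : ℝ, 0 < ε → ε < ε₀ → ∀ n : ℕ, 0 < n →
      N0 f (ε / 4 ^ n) ≤ ENNReal.ofReal ((1 - 7 * C ^ 2 / 36) ^ n * 4 ^ n / ε)) ∧
    False := by
  exfalso
  obtain ⟨δ₀, hδ₀, hlb⟩ := hlb
  obtain ⟨F, hFdef⟩ : ∃ F : ℝ → ℝ, F = fun x => f (max 0 (min 1 x)) := ⟨_, rfl⟩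
  have hFf : ∀ x ∈ Set.Icc (0:ℝ) 1, F x = f x := by
    rintro x ⟨h0, h1⟩
    rw [hFdef]; simp only
    rw [min_eq_right h1, max_eq_right h0]
  have hF : LipschitzWith 1 F := by
    apply LipschitzWith.of_dist_le_mul
    intro x y
    simp only [Real.dist_eq, NNReal.coe_one, one_mul]
    rw [hFdef]
    have m : ∀ x : ℝ, max 0 (min 1 x) ∈ Set.Icc (0:ℝ) 1 := fun x =>
      ⟨le_max_left _ _, max_le zero_le_one (min_le_left _ _)⟩
    refine (hlip _ (m x) _ (m y)).trans ?_
    exact aux_clamp x y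
  obtain ⟨τ₀, hτ₀, hsmall⟩ := aux_small F hF.continuous (C / 2) (by linarith)
  obtain ⟨δ, hδ, hδ'⟩ : ∃ δ : ℝ, 0 < δ ∧ δ < min δ₀ (min (C / 2) τ₀) :=
    exists_between (lt_min hδ₀ (lt_min (by linarith) hτ₀))
  have d1 : δ < δ₀ := hδ'.trans_le (min_le_left _ _)
  have d2 : δ < C / 2 := hδ'.trans_le ((min_le_right _ _).trans (min_le_left _ _))
  have d3 : δ < τ₀ := hδ'.trans_le ((min_le_right _ _).trans (min_le_right _ _))
  obtain ⟨M, hM⟩ := exists_nat_gt (4 / δ)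
  have hMpos : (0:ℝ) < M := lt_trans (by positivity) hM
  have hη : (1:ℝ) / M ≤ δ / 4 := by
    rw [div_lt_iff₀ hδ] at hM
    rw [div_le_iff₀ hMpos]; linarith
  obtain ⟨h, s, K, hc, hs, -, -, hclose, hcard, hpot⟩ :=
    aux_ind F hF δ (1 / M) hδ (by positivity) hη M
  have e : (M:ℝ) * (1 / M) = 1 := by field_simp
  rw [e] at hclose hcard hpot
  have hv := hsmall (δ / 2) (by linarith) (by linarith)
  have hK : K * δ < C := by
    have a1 : -(δ/2) ≤ max (-(δ / 2)) (min (δ / 2) (F 1)) := le_max_left _ _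
    have a2 : max (-(δ / 2)) (min (δ / 2) (F 1)) ≤ δ / 2 :=
      max_le (by linarith) (min_le_left _ _)
    rcases hs with rfl | rfl <;> linarith
  have hN : N0 f δ ≤ (K : ℝ≥0∞) := by
    unfold N0
    refine (iInf_le _ h).trans ((iInf_le _ hc.continuousOn).trans ((iInf_le _ ?_).trans ?_))
    · intro x hx
      rw [← hFf x hx]; exact hclose x hx.1 hx.2
    · apply aux_haus
      convert hcard using 4
      simp [Set.mem_Icc, and_assoc]
  have h1 := (hlb δ hδ d1).trans hN
  rw [← ENNReal.ofReal_natCast, ENNReal.ofReal_le_ofReal_iff (by positivity), div_le_iff₀ hδ] at h1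
  linarith
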